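/- arXiv:1407.3516 — 2 statements merged into one kernel-verified Lean document; each statement's English description precedes it below -/
import Mathlib

section
/- For all integers n, m with 2 ≤ m ≤ n, a(n,m) = ((m−1)/(n−1))·binomial(2n−m−2, n−2). -/
/-- A Catalan word: a word `a : Fin n → ℕ` satisfying (i) `a (i+1) ≥ a i - 1` for all
adjacent positions, and (ii) if `i` is the minimal index with `a i = k > 0`, then there
exist `i₁ < i < i₂` with `a i₁ = a i₂ = k - 1`. -/
def IsCatalanWord {n : ℕ} (a : Fin n → ℕ) : Prop :=
  (∀ (i : ℕ) (h : i + 1 < n), a ⟨i, Nat.lt_of_succ_lt h⟩ ≤ a ⟨i + 1, h⟩ + 1) ∧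
  (∀ i : Fin n, 0 < a i → (∀ j : Fin n, a j = a i → i ≤ j) →
    ((∃ i₁ : Fin n, i₁ < i ∧ a i₁ + 1 = a i) ∧ (∃ i₂ : Fin n, i < i₂ ∧ a i₂ + 1 = a i)))

/-- The number of letters of the word `a` equal to `c`. -/
noncomputable def countEq {n : ℕ} (a : Fin n → ℕ) (c : ℕ) : ℕ :=
  Set.ncard {i : Fin n | a i = c}

/-- `aZ n m` is the number of Catalan words of length `n` with exactly `m` zeros. -/
noncomputable def aZ (n m : ℕ) : ℕ :=
  Set.ncard {a : Fin n → ℕ | IsCatalanWord a ∧ countEq a 0 = m}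

namespace CatalanWord

open Finset

/-- Lower every positive letter of a word by one and erase the zeros. -/
def strip : List ℕ → List ℕ
  | [] => []
  | 0 :: l => strip l
  | (x + 1) :: l => x :: strip l

/-- The first occurrence of `k + 1`, if any, is preceded by an occurrence of `k`. -/
def Pre (k : ℕ) : List ℕ → Prop
  | [] => True
  | x :: l => x = k ∨ (x ≠ k + 1 ∧ Pre k l)

/-- The first occurrence of `k + 1`, if any, is followed by an occurrence of `k`. -/
def Post (k : ℕ) : List ℕ → Prop
  | [] => True
  | x :: l => (x = k + 1 ∧ k ∈ l) ∨ (x ≠ k + 1 ∧ Post k l)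

/-- Adjacent letters of a word drop by at most one. -/
abbrev SlowDescent : List ℕ → Prop := List.IsChain fun x y => x ≤ y + 1

/-- Catalan words, as lists. -/
def IsCat (l : List ℕ) : Prop := SlowDescent l ∧ ∀ k, Pre k l ∧ Post k l

theorem mem_strip (k : ℕ) (l : List ℕ) : k ∈ strip l ↔ k + 1 ∈ l := by
  induction l with
  | nil => simp [strip]
  | cons x l ih => cases x <;> simp [strip, ih]

theorem pre_strip (k : ℕ) (l : List ℕ) : Pre k (strip l) ↔ Pre (k + 1) l := by
  induction l with
  | nil => simp [strip, Pre]
  | cons x l ih => cases x <;> simp [strip, Pre, ih]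

theorem post_strip (k : ℕ) (l : List ℕ) : Post k (strip l) ↔ Post (k + 1) l := by
  induction l with
  | nil => simp [strip, Post]
  | cons x l ih => cases x <;> simp [strip, Post, ih, mem_strip]

theorem length_strip (l : List ℕ) : (strip l).length + l.count 0 = l.length := by
  induction l with
  | nil => simp [strip]
  | cons x l ih => cases x <;> simp [strip] <;> omega

theorem map_succ_strip (l : List ℕ) (h : 0 ∉ l) : (strip l).map Nat.succ = l := by
  induction l with
  | nil => simp [strip]
  | cons x l ih => cases x <;> simp_all [strip]

theorem slowDescent_strip (p : ℕ) (l : List ℕ) (h : SlowDescent (p :: l)) :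
    SlowDescent ((p - 1) :: strip l) := by
  induction l generalizing p with
  | nil => simp [strip]
  | cons x l ih =>
    rw [SlowDescent, List.isChain_cons_cons] at h
    have := ih x h.2
    cases x with
    | zero =>
      have hp : p - 1 = 0 := by omega
      simpa [strip, hp] using this
    | succ x =>
      simp only [strip, List.isChain_cons_cons]
      exact ⟨by omega, by simpa using this⟩

/-- The words with `m` zeros that strip to `b` and that may follow the letter `p`. -/
def lifts (p : ℕ) (b : List ℕ) (m : ℕ) : Set (List ℕ) :=
  {a | SlowDescent (p :: a) ∧ strip a = b ∧ a.count 0 = m}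

theorem mem_lifts_nil (p : ℕ) (b : List ℕ) (m : ℕ) :
    [] ∈ lifts p b m ↔ b = [] ∧ m = 0 := by
  simp [lifts, strip, eq_comm]

theorem mem_lifts_zero_cons (p : ℕ) (b : List ℕ) (m : ℕ) (a : List ℕ) :
    0 :: a ∈ lifts p b m ↔ p ≤ 1 ∧ ∃ m', m = m' + 1 ∧ a ∈ lifts 0 b m' := by
  cases m <;> simp [lifts, strip]
  tauto

theorem mem_lifts_succ_cons (p : ℕ) (b : List ℕ) (m x : ℕ) (a : List ℕ) :
    (x + 1) :: a ∈ lifts p b m ↔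
      p ≤ x + 2 ∧ ∃ b', b = x :: b' ∧ a ∈ lifts (x + 1) b' m := by
  cases b with
  | nil => simp [lifts, strip]
  | cons y b =>
    simp only [lifts, strip, Set.mem_ofPred_eq, List.isChain_cons_cons, List.cons.injEq,
      List.count_cons]
    constructor
    · rintro ⟨⟨h1, h2⟩, ⟨rfl, rfl⟩, h⟩
      exact ⟨h1, _, ⟨rfl, rfl⟩, h2, rfl, by simpa using h⟩
    · rintro ⟨h1, b', ⟨rfl, rfl⟩, h2, rfl, h⟩
      exact ⟨⟨h1, h2⟩, ⟨rfl, rfl⟩, by simpa using h⟩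

theorem lifts_nil_zero (p : ℕ) : lifts p [] 0 = {[]} := by
  ext a
  rcases a with _ | ⟨_ | x, a⟩ <;>
    simp [mem_lifts_nil, mem_lifts_zero_cons, mem_lifts_succ_cons]

theorem lifts_nil_succ (p m : ℕ) (hp : p ≤ 1) :
    lifts p [] (m + 1) = List.cons 0 '' lifts 0 [] m := by
  ext a
  rcases a with _ | ⟨_ | x, a⟩ <;>
    simp [mem_lifts_nil, mem_lifts_zero_cons, mem_lifts_succ_cons, hp]

theorem lifts_nil_of_two_le (p m : ℕ) (hp : 2 ≤ p) : lifts p [] (m + 1) = ∅ := by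
  have : ¬ p ≤ 1 := by omega
  ext a
  rcases a with _ | ⟨_ | x, a⟩ <;>
    simp [mem_lifts_nil, mem_lifts_zero_cons, mem_lifts_succ_cons, this]

theorem lifts_cons_zero (p y : ℕ) (b : List ℕ) (hp : p ≤ y + 2) :
    lifts p (y :: b) 0 = List.cons (y + 1) '' lifts (y + 1) b 0 := by
  ext a
  rcases a with _ | ⟨_ | x, a⟩
  · simp [mem_lifts_nil]
  · simp [mem_lifts_zero_cons]
  · simp only [mem_lifts_succ_cons, Set.mem_image, List.cons.injEq]
    grind

theorem lifts_cons_of_two_le (p y m : ℕ) (b : List ℕ) (hp : p ≤ y + 2) (h2 : 2 ≤ p) :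
    lifts p (y :: b) m = List.cons (y + 1) '' lifts (y + 1) b m := by
  ext a
  rcases a with _ | ⟨_ | x, a⟩
  · simp [mem_lifts_nil]
  · simp [mem_lifts_zero_cons]
    omega
  · simp only [mem_lifts_succ_cons, Set.mem_image, List.cons.injEq]
    grind

theorem lifts_cons_succ (p y m : ℕ) (b : List ℕ) (hp : p ≤ 1) :
    lifts p (y :: b) (m + 1) =
      List.cons 0 '' lifts 0 (y :: b) m ∪ List.cons (y + 1) '' lifts (y + 1) b (m + 1) := by
  ext a
  rcases a with _ | ⟨_ | x, a⟩
  · simp [mem_lifts_nil]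
  · simp [mem_lifts_zero_cons, hp]
  · simp only [mem_lifts_succ_cons, Set.mem_image, List.cons.injEq, Set.mem_union]
    grind

theorem encard_lifts (p m : ℕ) (b : List ℕ) (h : SlowDescent ((p - 1) :: b)) :
    (lifts p b m).encard = Nat.multichoose (b.count 0 + if p ≤ 1 then 1 else 0) m := by
  have inj : ∀ x : ℕ, Function.Injective (List.cons x) := fun x => List.cons_injective
  induction b generalizing p m with
  | nil =>
    induction m generalizing p with
    | zero => simp [lifts_nil_zero]
    | succ m ih =>
      by_cases hp : p ≤ 1
      · rw [lifts_nil_succ p m hp, (inj _).encard_image, ih 0 (by simp)]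
        simp [hp]
      · rw [lifts_nil_of_two_le p m (by omega)]
        simp [hp]
  | cons y b ihb =>
    have hcount : b.count 0 + (if y + 1 ≤ 1 then 1 else 0) = (y :: b).count 0 := by
      cases y <;> simp
    rw [SlowDescent, List.isChain_cons_cons] at h
    have key : ∀ m, (List.cons (y + 1) '' lifts (y + 1) b m).encard =
        Nat.multichoose ((y :: b).count 0) m := fun m => by
      rw [(inj _).encard_image, ihb (y + 1) m (by simpa using h.2), hcount]
    by_cases hp : p ≤ 1
    · rw [if_pos hp]
      induction m generalizing p with
      | zero => rw [lifts_cons_zero p y b (by omega), key]; simp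
      | succ m ih =>
        rw [lifts_cons_succ p y m b hp, Set.encard_union_eq, key, (inj _).encard_image,
          ih 0 ⟨by omega, h.2⟩ (by omega), Nat.multichoose_succ_succ]
        · push_cast; ring
        · rw [Set.disjoint_left]
          rintro _ ⟨a, -, rfl⟩ ⟨a', -, h⟩
          simp at h
    · rw [lifts_cons_of_two_le p y m b (by omega) (by omega), key]
      simp [hp]

theorem not_post_zero_iff (l b : List ℕ) (h : strip l = 0 :: b) :
    ¬ Post 0 l ↔ l = List.replicate (l.count 0) 0 ++ (0 :: b).map Nat.succ := by
  induction l with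
  | nil => simp [strip] at h
  | cons x l ih =>
    rcases x with _ | x
    · simp only [strip] at h
      have := ih h
      simp only [Post, List.count_cons_self, List.replicate_succ, List.cons_append,
        List.cons.injEq, true_and, ← this]
      simp
    · simp only [strip, List.cons.injEq] at h
      obtain ⟨rfl, rfl⟩ := h
      have hc : List.count 0 ((0 + 1) :: l) = l.count 0 := by simp
      rw [hc]
      by_cases h0 : 0 ∈ l
      · obtain ⟨c, hc⟩ : ∃ c, l.count 0 = c + 1 :=
          Nat.exists_eq_succ_of_ne_zero (List.count_pos_iff.2 h0).ne'
        simp [Post, h0, hc, List.replicate_succ]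
      · simp [Post, h0, List.count_eq_zero.2 h0, map_succ_strip l h0]

theorem strip_replicate_append (m : ℕ) (b : List ℕ) :
    strip (List.replicate m 0 ++ b.map Nat.succ) = b := by
  induction m with
  | zero =>
    induction b with
    | nil => simp [strip]
    | cons x b ih => simp_all [strip]
  | succ m ih => simpa [List.replicate_succ, strip] using ih

theorem count_replicate_append (m : ℕ) (b : List ℕ) :
    (List.replicate m 0 ++ b.map Nat.succ).count 0 = m := by
  simp [List.count_eq_zero]

theorem slowDescent_replicate_append (m : ℕ) (b : List ℕ) (h : SlowDescent b) :
    SlowDescent (0 :: (List.replicate m 0 ++ b.map Nat.succ)) := by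
  induction m with
  | zero =>
    cases b with
    | nil => simp
    | cons x b =>
      simp only [List.replicate_zero, List.nil_append, List.map_cons, List.isChain_cons_cons]
      refine ⟨by omega, ?_⟩
      rw [← List.map_cons, List.isChain_map]
      simpa using h
  | succ m ih =>
    rw [List.replicate_succ, List.cons_append, SlowDescent, List.isChain_cons_cons]
    exact ⟨by omega, ih⟩

theorem IsCat.head_eq_zero {x : ℕ} {l : List ℕ} (h : IsCat (x :: l)) : x = 0 := by
  cases x with
  | zero => rfl
  | succ x => simpa [Pre] using (h.2 x).1

theorem IsCat.strip {l : List ℕ} (h : IsCat l) : IsCat (strip l) := by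
  refine ⟨?_, fun k => ⟨(pre_strip k l).2 (h.2 _).1, (post_strip k l).2 (h.2 _).2⟩⟩
  have : SlowDescent (0 :: l) := by
    cases l with
    | nil => simp
    | cons x l => exact List.isChain_cons_cons.2 ⟨by omega, h.1⟩
  exact (slowDescent_strip 0 l this).tail

theorem isCat_fiber (b : List ℕ) (m : ℕ) (hb : IsCat b) (hne : b ≠ []) :
    {l | IsCat l ∧ l.count 0 = m + 1 ∧ strip l = b} =
      List.cons 0 '' (lifts 0 b m \ {List.replicate m 0 ++ b.map Nat.succ}) := by
  obtain ⟨y, b, rfl⟩ := List.exists_cons_of_ne_nil hne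
  obtain rfl := hb.head_eq_zero
  ext l
  constructor
  · rintro ⟨hl, hc, hs⟩
    cases l with
    | nil => simp at hc
    | cons x l =>
      obtain rfl := hl.head_eq_zero
      have hc' : l.count 0 = m := by simpa using hc
      have hs' : strip l = 0 :: b := hs
      refine ⟨l, ⟨⟨hl.1, hs', hc'⟩, ?_⟩, rfl⟩
      have hp : Post 0 l := by simpa [Post] using (hl.2 0).2
      rw [Set.mem_singleton_iff, ← hc', ← not_post_zero_iff l b hs']
      exact not_not.2 hp
  · rintro ⟨l, ⟨⟨h1, hs, hc⟩, hne'⟩, rfl⟩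
    rw [Set.mem_singleton_iff, ← hc, ← not_post_zero_iff l b hs, not_not] at hne'
    refine ⟨⟨h1, fun k => ?_⟩, by simpa using hc, hs⟩
    cases k with
    | zero => simp [Pre, Post, hne']
    | succ k =>
      rw [← pre_strip, ← post_strip]
      simp only [strip, hs]
      exact hb.2 k

theorem ncard_isCat_fiber (b : List ℕ) (m : ℕ) (hb : IsCat b) (hne : b ≠ []) :
    {l | IsCat l ∧ l.count 0 = m + 1 ∧ strip l = b}.ncard + 1 =
      Nat.multichoose (b.count 0 + 1) m := by
  have hmem : List.replicate m 0 ++ b.map Nat.succ ∈ lifts 0 b m :=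
    ⟨slowDescent_replicate_append m b hb.1, strip_replicate_append m b,
      count_replicate_append m b⟩
  have hd : SlowDescent ((0 - 1) :: b) := by
    cases b with
    | nil => simp
    | cons x l => exact List.isChain_cons_cons.2 ⟨by omega, hb.1⟩
  have hcard := encard_lifts 0 m b hd
  rw [if_pos (by omega)] at hcard
  rw [isCat_fiber b m hb hne, Set.ncard_image_of_injective _ List.cons_injective,
    Set.ncard_sdiff_singleton_add_one hmem (Set.finite_of_encard_eq_coe hcard), Set.ncard, hcard]
  rfl

theorem IsCat.mem_of_succ_mem {l : List ℕ} (h : IsCat l) (k : ℕ) (hk : k + 1 ∈ l) : k ∈ l := by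
  have := (h.2 k).1
  clear h
  induction l with
  | nil => simp at hk
  | cons x l ih =>
    simp only [Pre, List.mem_cons] at *
    grind

theorem IsCat.lt_length {l : List ℕ} (h : IsCat l) {k : ℕ} (hk : k ∈ l) : k < l.length := by
  have hsub : ∀ i, k - i ∈ l := fun i => by
    induction i with
    | zero => exact hk
    | succ i ih =>
      by_cases hi : i < k
      · exact h.mem_of_succ_mem _ (by rwa [show k - (i + 1) + 1 = k - i by omega])
      · rwa [show k - (i + 1) = k - i by omega]
  have : range (k + 1) ⊆ l.toFinset := fun i hi => by
    have := hsub (k - i)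
    rw [mem_range] at hi
    rw [show k - (k - i) = i by omega] at this
    simpa using this
  have := (card_le_card this).trans l.toFinset_card_le
  simpa using this

theorem finite_isCat (n : ℕ) : {l | IsCat l ∧ l.length = n}.Finite := by
  refine ((List.finite_length_eq (Fin n) n).image (List.map Fin.val)).subset ?_
  rintro l ⟨h, rfl⟩
  refine ⟨l.attach.map fun x => ⟨x.1, h.lt_length x.2⟩, by simp, by simp [Function.comp_def]⟩

/-- The Catalan words of length `n`. -/
noncomputable def words (n : ℕ) : Finset (List ℕ) := (finite_isCat n).toFinset

theorem mem_words {n : ℕ} {l : List ℕ} : l ∈ words n ↔ IsCat l ∧ l.length = n := by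
  simp [words]

/-- The number of Catalan words of length `n` with `m` zeros. -/
noncomputable def numWords (n m : ℕ) : ℕ := #{l ∈ words n | l.count 0 = m}

theorem numWords_succ_zero (n : ℕ) : numWords (n + 1) 0 = 0 := by
  rw [numWords, card_eq_zero, filter_eq_empty_iff]
  intro l hl h0
  rw [mem_words] at hl
  obtain ⟨h, hlen⟩ := hl
  cases l with
  | nil => simp at hlen
  | cons x l =>
    obtain rfl := h.head_eq_zero
    simp at h0

theorem isCat_replicate (n : ℕ) : IsCat (List.replicate n 0) := by
  refine ⟨List.isChain_replicate_of_rel n (by omega), fun k => ?_⟩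
  induction n with
  | zero => simp [Pre, Post]
  | succ n ih => simp [List.replicate_succ, Pre, Post, ih]

theorem numWords_self (n : ℕ) : numWords n n = 1 := by
  rw [numWords, card_eq_one]
  refine ⟨List.replicate n 0, ?_⟩
  ext l
  simp only [mem_filter, mem_words, mem_singleton]
  constructor
  · rintro ⟨⟨-, h⟩, h'⟩
    rw [List.eq_replicate_iff]
    refine ⟨h, fun x hx => ((List.count_eq_length.1 (h'.trans h.symm)) x hx).symm⟩
  · rintro rfl
    exact ⟨⟨isCat_replicate n, by simp⟩, by simp⟩

theorem numWords_eq_sum (N m : ℕ) (hN : 0 < N) :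
    (numWords (N + (m + 1)) (m + 1) : ℤ) =
      ∑ j ∈ range (N + 1), numWords N j * ((Nat.multichoose (j + 1) m : ℤ) - 1) := by
  have hmap : ∀ l ∈ ({l ∈ words (N + (m + 1)) | l.count 0 = m + 1} : Finset (List ℕ)),
      strip l ∈ words N := by
    intro l hl
    rw [mem_filter, mem_words] at hl
    have := length_strip l
    exact mem_words.2 ⟨hl.1.1.strip, by omega⟩
  have hfib : ∀ b ∈ words N,
      ((#{l ∈ {l ∈ words (N + (m + 1)) | l.count 0 = m + 1} | strip l = b} : ℕ) : ℤ) =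
        (Nat.multichoose (b.count 0 + 1) m : ℤ) - 1 := by
    intro b hb
    rw [mem_words] at hb
    have hne : b ≠ [] := by
      rintro rfl
      simp at hb
      omega
    rw [← ncard_isCat_fiber b m hb.1 hne, ← Set.ncard_coe_finset]
    push_cast
    rw [add_sub_cancel_right]
    congr 2
    ext l
    have := length_strip l
    simp only [mem_filter, mem_words, Set.mem_ofPred_eq]
    grind
  have hcount : ∀ b ∈ words N, b.count 0 ∈ range (N + 1) := by
    intro b hb
    rw [mem_words] at hb
    have := List.count_le_length (a := 0) (l := b)
    rw [mem_range]
    omega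
  rw [numWords, card_eq_sum_card_fiberwise hmap, Nat.cast_sum, sum_congr rfl hfib,
    ← sum_fiberwise_of_maps_to hcount]
  refine sum_congr rfl fun j _ => ?_
  rw [numWords, sum_congr rfl (g := fun _ => (Nat.multichoose (j + 1) m : ℤ) - 1), sum_const,
    nsmul_eq_mul]
  intro b hb
  rw [(mem_filter.1 hb).2]

/-- The ballot numbers: `ballot k N` is the `N`-th coefficient of the `k`-th power of the
generating function of the Catalan numbers. -/
def ballot : ℕ → ℕ → ℕ
  | _, 0 => 1
  | 0, _ + 1 => 0
  | k + 1, N + 1 => ballot k (N + 1) + ballot (k + 2) N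
termination_by k N => (N, k)

theorem ballot_zero_right (k : ℕ) : ballot k 0 = 1 := by
  rw [ballot]

theorem ballot_zero_succ (N : ℕ) : ballot 0 (N + 1) = 0 := by
  rw [ballot]

theorem ballot_succ_succ (k N : ℕ) :
    ballot (k + 1) (N + 1) = ballot k (N + 1) + ballot (k + 2) N := by
  rw [ballot]

theorem ballot_mul (k N : ℕ) (h : 0 < N + k) :
    (ballot k N : ℚ) * (N + k) = k * Nat.choose (2 * N + k - 1) N := by
  induction N generalizing k with
  | zero => simp [ballot_zero_right]
  | succ N ihN =>
    induction k with
    | zero => simp [ballot_zero_succ]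
    | succ k ihk =>
      have h1 := ihk (by omega)
      have h2 := ihN (k + 2) (by omega)
      rw [show 2 * (N + 1) + k - 1 = 2 * N + k + 1 by omega] at h1
      rw [show 2 * N + (k + 2) - 1 = 2 * N + k + 1 by omega] at h2
      rw [show 2 * (N + 1) + (k + 1) - 1 = 2 * N + k + 1 + 1 by omega, Nat.choose_succ_succ,
        ballot_succ_succ]
      have h3 := Nat.choose_succ_right_eq (2 * N + k + 1) N
      rw [show 2 * N + k + 1 - N = N + k + 1 by omega] at h3
      have h4 : (Nat.choose (2 * N + k + 1) (N + 1) : ℚ) * (N + 1) =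
        Nat.choose (2 * N + k + 1) N * (N + k + 1) := by exact_mod_cast h3
      have h5 : ((N : ℚ) + k + 1) ≠ 0 := by positivity
      push_cast at h1 h2 ⊢
      apply mul_right_cancel₀ h5
      linear_combination (N + k + 2 : ℚ) * h1 + (N + k + 1 : ℚ) * h2 - h4

theorem sum_mul_eq_sum_mul_of_sub (M : ℕ) (f g H : ℕ → ℤ) (hM : g M = f M)
    (hg : ∀ s < M, g s = f s + g (s + 1)) (h0 : H 0 = 0) :
    ∑ s ∈ range (M + 1), g s * (H (s + 1) - H s) = ∑ s ∈ range (M + 1), f s * H (s + 1) := by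
  rw [sum_range_succ, sum_range_succ, hM]
  have : ∑ s ∈ range M, (f s * H (s + 1) - g s * (H (s + 1) - H s)) =
      ∑ s ∈ range M, (g s * H s - g (s + 1) * H (s + 1)) := by
    refine sum_congr rfl fun s hs => ?_
    rw [hg s (mem_range.1 hs)]
    ring
  rw [sum_range_sub' (fun s => g s * H s), sum_sub_distrib, h0, hM] at this
  linarith

theorem ballot_eq_sum (N k : ℕ) :
    (ballot k (N + 1) : ℤ) =
      ∑ i ∈ range (N + 1), ballot i (N - i) * ((Nat.multichoose (i + 2) k : ℤ) - 1) := by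
  induction N generalizing k with
  | zero =>
    induction k with
    | zero => simp [ballot_zero_succ]
    | succ k ih =>
      rw [ballot_succ_succ]
      push_cast
      rw [ih]
      simp [ballot_zero_right, Nat.multichoose_two]
  | succ N ihN =>
    induction k with
    | zero => simp [ballot_zero_succ]
    | succ k ihk =>
      rw [ballot_succ_succ]
      push_cast
      rw [ihk, ihN (k + 2)]
      have abel := sum_mul_eq_sum_mul_of_sub N (fun s => ballot s (N - s))
        (fun s => ballot (s + 1) (N - s)) (fun s => (Nat.multichoose (s + 1) (k + 2) : ℤ) - 1)
        (by simp [ballot_zero_right])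
        (fun s hs => by
          obtain ⟨d, rfl⟩ : ∃ d, N = s + d + 1 := ⟨N - s - 1, by omega⟩
          rw [show s + d + 1 - s = d + 1 by omega, show s + d + 1 - (s + 1) = d by omega,
            ballot_succ_succ]
          push_cast
          ring)
        (by simp)
      rw [← abel, ← eq_sub_iff_add_eq', ← sum_sub_distrib, sum_range_succ' _ (N + 1)]
      simp only [Nat.sub_zero, ballot_zero_succ, Nat.add_sub_add_right]
      simp only [Nat.multichoose_succ_succ, Nat.cast_add]
      simp only [Nat.cast_zero, zero_mul, sub_zero, add_zero]
      refine sum_congr rfl fun s _ => ?_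
      ring

theorem numWords_eq_ballot (N k : ℕ) : numWords (N + (k + 1)) (k + 1) = ballot k N := by
  induction N using Nat.strong_induction_on generalizing k with
  | _ N ih =>
    cases N with
    | zero => rw [zero_add, numWords_self, ballot_zero_right]
    | succ N =>
      rw [← Nat.cast_inj (R := ℤ), numWords_eq_sum _ _ (Nat.succ_pos N), ballot_eq_sum,
        sum_range_succ', numWords_succ_zero]
      simp only [Nat.cast_zero, zero_mul, add_zero]
      refine sum_congr rfl fun i hi => ?_
      rw [mem_range] at hi
      rw [← ih (N - i) (by omega) i, show N - i + (i + 1) = N + 1 by omega]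

theorem count_ofFn_zero {n : ℕ} (a : Fin n → ℕ) : (List.ofFn a).count 0 = countEq a 0 := by
  rw [countEq, Set.ncard_eq_toFinset_card']
  simp only [Set.toFinset_ofPred]
  induction n with
  | zero => simp
  | succ n ih =>
    rw [List.ofFn_succ, List.count_cons, ih, Fin.card_filter_univ_succ]
    simp only [beq_iff_eq]
    split_ifs <;> rfl

theorem pre_iff (k : ℕ) (l : List ℕ) :
    Pre k l ↔ ∀ i : ℕ, l[i]? = some (k + 1) → (∀ j : ℕ, l[j]? = some (k + 1) → i ≤ j) →
      ∃ j < i, l[j]? = some k := by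
  induction l with
  | nil => simp [Pre]
  | cons x l ih =>
    rw [Pre, ih]
    constructor
    · rintro (rfl | ⟨hx, h⟩) i hi hmin
      · rcases i with _ | i
        · simp at hi
        · exact ⟨0, by omega, by simp⟩
      · rcases i with _ | i
        · simp_all
        · obtain ⟨j, hj, hk⟩ := h i (by simpa using hi) fun j hj => by
            have := hmin (j + 1) (by simpa using hj)
            omega
          exact ⟨j + 1, by omega, by simpa using hk⟩
    · intro h
      by_cases hxk : x = k
      · exact Or.inl hxk
      · refine Or.inr ⟨?_, fun i hi hmin => ?_⟩
        · rintro rfl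
          obtain ⟨j, hj, -⟩ := h 0 (by simp) (fun _ _ => Nat.zero_le _)
          omega
        · by_cases hx : x = k + 1
          · obtain ⟨j, hj, -⟩ := h 0 (by simp [hx]) (fun _ _ => Nat.zero_le _)
            omega
          obtain ⟨j, hj, hk⟩ := h (i + 1) (by simpa using hi) fun j hj => by
            rcases j with _ | j
            · simp [hx] at hj
            · have := hmin j (by simpa using hj)
              omega
          rcases j with _ | j
          · simp [hxk] at hk
          · exact ⟨j, by omega, by simpa using hk⟩

theorem post_iff (k : ℕ) (l : List ℕ) :
    Post k l ↔ ∀ i : ℕ, l[i]? = some (k + 1) → (∀ j : ℕ, l[j]? = some (k + 1) → i ≤ j) →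
      ∃ j > i, l[j]? = some k := by
  induction l with
  | nil => simp [Post]
  | cons x l ih =>
    rw [Post, ih]
    constructor
    · rintro (⟨rfl, hk⟩ | ⟨hx, h⟩) i hi hmin
      · have hi0 : i = 0 := by simpa using hmin 0 (by simp)
        obtain ⟨j, hj⟩ := List.mem_iff_getElem?.1 hk
        exact ⟨j + 1, by omega, by simpa using hj⟩
      · rcases i with _ | i
        · simp_all
        · obtain ⟨j, hj, hk⟩ := h i (by simpa using hi) fun j hj => by
            have := hmin (j + 1) (by simpa using hj)
            omega
          exact ⟨j + 1, by omega, by simpa using hk⟩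
    · intro h
      by_cases hx : x = k + 1
      · obtain ⟨j, hj, hk⟩ := h 0 (by simp [hx]) (fun _ _ => Nat.zero_le _)
        rcases j with _ | j
        · omega
        · exact Or.inl ⟨hx, List.mem_iff_getElem?.2 ⟨j, by simpa using hk⟩⟩
      · refine Or.inr ⟨hx, fun i hi hmin => ?_⟩
        obtain ⟨j, hj, hk⟩ := h (i + 1) (by simpa using hi) fun j hj => by
          rcases j with _ | j
          · simp [hx] at hj
          · have := hmin j (by simpa using hj)
            omega
        rcases j with _ | j
        · omega
        · exact ⟨j, by omega, by simpa using hk⟩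

theorem getElem?_ofFn_eq_some {n : ℕ} (a : Fin n → ℕ) (i x : ℕ) :
    (List.ofFn a)[i]? = some x ↔ ∃ h : i < n, a ⟨i, h⟩ = x := by
  rw [List.getElem?_eq_some_iff]
  simp

theorem isCat_ofFn {n : ℕ} (a : Fin n → ℕ) : IsCat (List.ofFn a) ↔ IsCatalanWord a := by
  refine and_congr ?_ ?_
  · rw [SlowDescent, List.isChain_iff_getElem]
    simp
  · simp only [pre_iff, post_iff, getElem?_ofFn_eq_some]
    constructor
    · intro h i hi hmin
      obtain ⟨k, hk⟩ := Nat.exists_eq_succ_of_ne_zero hi.ne'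
      have hmin' : ∀ j, (∃ h : j < n, a ⟨j, h⟩ = k + 1) → (i : ℕ) ≤ j := by
        rintro j ⟨hj, h⟩
        exact hmin ⟨j, hj⟩ (h.trans hk.symm)
      obtain ⟨j₁, hj₁, h₁, e₁⟩ := (h k).1 i ⟨i.2, hk⟩ hmin'
      obtain ⟨j₂, hj₂, h₂, e₂⟩ := (h k).2 i ⟨i.2, hk⟩ hmin'
      exact ⟨⟨⟨j₁, h₁⟩, hj₁, by omega⟩, ⟨⟨j₂, h₂⟩, hj₂, by omega⟩⟩
    · intro h k
      rw [← forall_and]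
      intro i
      rw [← imp_and, ← imp_and]
      rintro ⟨hi, hk⟩ hmin
      obtain ⟨⟨j₁, hj₁, e₁⟩, j₂, hj₂, e₂⟩ := h ⟨i, hi⟩ (by omega) fun j hj =>
        hmin j ⟨j.2, hj.trans hk⟩
      exact ⟨⟨j₁, hj₁, j₁.2, by simp; omega⟩, ⟨j₂, hj₂, j₂.2, by simp; omega⟩⟩

theorem aZ_eq_numWords (n m : ℕ) : aZ n m = numWords n m := by
  rw [aZ, numWords, ← Set.ncard_coe_finset,
    ← Set.ncard_image_of_injective _ (List.ofFn_injective (n := n) (α := ℕ))]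
  congr 1
  ext l
  simp only [coe_filter, mem_words, Set.mem_ofPred_eq, Set.mem_image, ← isCat_ofFn,
    ← count_ofFn_zero]
  constructor
  · rintro ⟨a, ⟨h, h'⟩, rfl⟩
    exact ⟨⟨h, by simp⟩, h'⟩
  · rintro ⟨⟨h, rfl⟩, h'⟩
    exact ⟨l.get, by simpa using ⟨h, h'⟩, by simp⟩

end CatalanWord

/-- Explicit formula: `a(n,m) = ((m-1)/(n-1)) * choose (2n-m-2) (n-2)` for `2 ≤ m ≤ n`. -/
theorem aZ_formula (n m : ℕ) (hm : 2 ≤ m) (hmn : m ≤ n) :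
    (aZ n m : ℚ) = ((m : ℚ) - 1) / ((n : ℚ) - 1) * (Nat.choose (2 * n - m - 2) (n - 2) : ℚ) := by
  obtain ⟨k, rfl⟩ : ∃ k, m = k + 1 + 1 := ⟨m - 2, by omega⟩
  obtain ⟨N, rfl⟩ : ∃ N, n = N + (k + 1 + 1) := ⟨n - (k + 1 + 1), by omega⟩
  have h := CatalanWord.ballot_mul (k + 1) N (by omega)
  rw [CatalanWord.aZ_eq_numWords, CatalanWord.numWords_eq_ballot,
    show 2 * (N + (k + 1 + 1)) - (k + 1 + 1) - 2 = N + k + N by omega,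
    show N + (k + 1 + 1) - 2 = N + k by omega, Nat.choose_symm_add]
  rw [show 2 * N + (k + 1) - 1 = N + k + N by omega] at h
  have h1 : (N : ℚ) + (k + 1) ≠ 0 := by positivity
  push_cast at h ⊢
  rw [show (N : ℚ) + (k + 1 + 1) - 1 = N + (k + 1) by ring,
    show (k : ℚ) + 1 + 1 - 1 = k + 1 by ring, div_mul_eq_mul_div, eq_div_iff h1, h]
end

section
/- For all real numbers x, v with 0 < x < 1/5 and 0 ≤ v ≤ 1, the series defining A(x,v) and A(x, 1/(1−xv)) converge, and A(x,v) = (xv/(1−xv))·(1 − x·C(x)) + (xv/(1−xv))·A(x, 1/(1−xv)). -/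
/-- `C(x) = (1 - √(1-4x))/(2x)`, the generating function of the Catalan numbers. -/
noncomputable def Cfun (x : ℝ) : ℝ := (1 - Real.sqrt (1 - 4*x)) / (2*x)

/-- The `n`-th term (a finite sum over `m`) of the double series
`A(x,u) = Σ_{n≥1} Σ_{m=1}^n a(n,m) xⁿ uᵐ`.  (The term for `n = 0` is `0`.) -/
noncomputable def Aterm (x u : ℝ) (n : ℕ) : ℝ :=
  ∑ m ∈ Finset.Icc 1 n, (aZ n m : ℝ) * x ^ n * u ^ m

/-- Adjacent letters of the list descend by at most one. -/
def DescendsByOne (a : List ℕ) : Prop :=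
  a.IsChain fun x y => x ≤ y + 1

/-- The first occurrence of `k + 1` in the list, if any, lies between two occurrences of `k`. -/
def FirstBracketed (k : ℕ) (a : List ℕ) : Prop :=
  k + 1 ∈ a → k ∈ a.takeWhile (· ≠ k + 1) ∧ k ∈ a.dropWhile (· ≠ k + 1)

/-- The list form of `IsCatalanWord`. -/
def IsCatalanList (a : List ℕ) : Prop :=
  DescendsByOne a ∧ ∀ k, FirstBracketed k a

/-- Delete the zeros of a list and decrease the remaining letters by one. -/
def lowerLetters : List ℕ → List ℕ
  | [] => []
  | 0 :: a => lowerLetters a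
  | (c + 1) :: a => c :: lowerLetters a

@[simp] lemma lowerLetters_nil : lowerLetters [] = [] := rfl

@[simp] lemma lowerLetters_zero_cons (a : List ℕ) :
    lowerLetters (0 :: a) = lowerLetters a := rfl

@[simp] lemma lowerLetters_succ_cons (c : ℕ) (a : List ℕ) :
    lowerLetters ((c + 1) :: a) = c :: lowerLetters a := rfl

lemma mem_lowerLetters {k : ℕ} {a : List ℕ} : k ∈ lowerLetters a ↔ k + 1 ∈ a := by
  induction a with
  | nil => simp
  | cons c a ih => cases c <;> simp [ih]

lemma length_lowerLetters_add_count (a : List ℕ) :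
    (lowerLetters a).length + a.count 0 = a.length := by
  induction a with
  | nil => simp
  | cons c a ih => cases c <;> simp <;> omega

lemma lowerLetters_takeWhile (k : ℕ) (a : List ℕ) :
    lowerLetters (a.takeWhile (· ≠ k + 1)) = (lowerLetters a).takeWhile (· ≠ k) := by
  induction a with
  | nil => simp
  | cons c a ih =>
    rcases c with _ | c
    · simpa using ih
    · by_cases h : c = k
      · simp [h]
      · simpa [List.takeWhile_cons, h] using ih

lemma lowerLetters_dropWhile (k : ℕ) (a : List ℕ) :
    lowerLetters (a.dropWhile (· ≠ k + 1)) = (lowerLetters a).dropWhile (· ≠ k) := by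
  induction a with
  | nil => simp
  | cons c a ih =>
    rcases c with _ | c
    · simpa using ih
    · by_cases h : c = k
      · simp [h]
      · simpa [List.dropWhile_cons, h] using ih

lemma firstBracketed_lowerLetters {k : ℕ} {a : List ℕ} :
    FirstBracketed k (lowerLetters a) ↔ FirstBracketed (k + 1) a := by
  unfold FirstBracketed
  rw [mem_lowerLetters, ← lowerLetters_takeWhile, ← lowerLetters_dropWhile, mem_lowerLetters,
    mem_lowerLetters]

lemma descendsByOne_zero_cons {a : List ℕ} : DescendsByOne (0 :: a) ↔ DescendsByOne a := by
  simp [DescendsByOne, List.isChain_cons]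

lemma descendsByOne_succ_cons {c : ℕ} {a : List ℕ} :
    DescendsByOne ((c + 1) :: a) ↔ (∀ y ∈ a.head?, c ≤ y) ∧ DescendsByOne a := by
  simp [DescendsByOne, List.isChain_cons]

lemma DescendsByOne.lowerLetters {a : List ℕ} (h : DescendsByOne a) :
    DescendsByOne (lowerLetters a) := by
  induction a with
  | nil => simp [DescendsByOne]
  | cons c a ih =>
    rcases c with _ | c
    · exact ih (descendsByOne_zero_cons.1 h)
    · rw [descendsByOne_succ_cons] at h
      have ih := ih h.2
      rcases c with _ | c
      · exact descendsByOne_zero_cons.2 ih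
      · refine descendsByOne_succ_cons.2 ⟨?_, ih⟩
        rcases a with _ | ⟨_ | d, a⟩ <;> simp at h ⊢
        omega

/-- The descending-by-one lists with `m` zeros which `lowerLetters` sends to `b`. -/
def insertions (b : List ℕ) (m : ℕ) : Set (List ℕ) :=
  {a | DescendsByOne a ∧ lowerLetters a = b ∧ a.count 0 = m}

/-- The members of `insertions b m` which do not start with zero. -/
def properInsertions (b : List ℕ) (m : ℕ) : Set (List ℕ) :=
  {a | a ∈ insertions b m ∧ a.head? ≠ some 0}

/-- The members of `insertions b m` in which a `0` follows the first `1`. -/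
def closedInsertions (b : List ℕ) (m : ℕ) : Set (List ℕ) :=
  {a | a ∈ insertions b m ∧ 0 ∈ a.dropWhile (· ≠ 1)}

lemma insertions_zero (b : List ℕ) : insertions b 0 = properInsertions b 0 := by
  ext a
  rcases a with _ | ⟨_ | c, a⟩ <;> simp [insertions, properInsertions]

lemma insertions_succ (b : List ℕ) (m : ℕ) :
    insertions b (m + 1) = (List.cons 0) '' insertions b m ∪ properInsertions b (m + 1) := by
  ext a
  rcases a with _ | ⟨_ | c, a⟩ <;>
    simp [insertions, properInsertions, descendsByOne_zero_cons]

lemma properInsertions_nil_zero : properInsertions [] 0 = {[]} := by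
  ext a
  rcases a with _ | ⟨_ | c, a⟩ <;> simp [insertions, properInsertions, DescendsByOne]

lemma properInsertions_nil_succ (m : ℕ) : properInsertions [] (m + 1) = ∅ := by
  ext a
  rcases a with _ | ⟨_ | c, a⟩ <;> simp [insertions, properInsertions]

lemma properInsertions_zero_cons (b : List ℕ) (m : ℕ) :
    properInsertions (0 :: b) m = (List.cons 1) '' insertions b m := by
  ext a
  rcases a with _ | ⟨_ | c, a⟩ <;>
    simp [insertions, properInsertions, descendsByOne_succ_cons]
  constructor
  · rintro ⟨⟨-, h⟩, ⟨rfl, h'⟩, h''⟩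
    exact ⟨⟨h, h', h''⟩, rfl⟩
  · rintro ⟨⟨h, h', h''⟩, rfl⟩
    exact ⟨⟨by simp, h⟩, ⟨rfl, h'⟩, h''⟩

lemma properInsertions_succ_cons {c : ℕ} {b : List ℕ} (hb : DescendsByOne ((c + 1) :: b))
    (m : ℕ) :
    properInsertions ((c + 1) :: b) m = (List.cons (c + 2)) '' properInsertions b m := by
  rw [descendsByOne_succ_cons] at hb
  ext a
  rcases a with _ | ⟨_ | d, a⟩
  · simp [insertions, properInsertions]
  · simp [insertions, properInsertions]
  · simp [insertions, properInsertions, descendsByOne_succ_cons]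
    constructor
    · rintro ⟨⟨h1, h⟩, ⟨rfl, h'⟩, h''⟩
      refine ⟨⟨⟨h, h', h''⟩, ?_⟩, rfl⟩
      intro h0
      have := h1 0 h0
      omega
    · rintro ⟨⟨⟨h, h', h''⟩, h0⟩, rfl⟩
      refine ⟨⟨?_, h⟩, ⟨rfl, h'⟩, h''⟩
      rcases a with _ | ⟨_ | d, a⟩
      · simp
      · simp at h0
      · subst h'
        simpa using hb.1

lemma finite_insertions_of_proper {b : List ℕ} (h : ∀ m, (properInsertions b m).Finite) (m : ℕ) :
    (insertions b m).Finite := by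
  induction m with
  | zero => exact insertions_zero b ▸ h 0
  | succ m ih => exact insertions_succ b m ▸ (ih.image _).union (h _)

lemma finite_properInsertions {b : List ℕ} (hb : DescendsByOne b) (m : ℕ) :
    (properInsertions b m).Finite := by
  induction b generalizing m with
  | nil =>
    rcases m with _ | m
    · simp [properInsertions_nil_zero]
    · simp [properInsertions_nil_succ]
  | cons c b ih =>
    rcases c with _ | c
    · rw [properInsertions_zero_cons]
      exact (finite_insertions_of_proper (ih (descendsByOne_zero_cons.1 hb)) m).image _
    · rw [properInsertions_succ_cons hb]
      exact (ih (descendsByOne_succ_cons.1 hb).2 m).image _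

lemma finite_insertions {b : List ℕ} (hb : DescendsByOne b) (m : ℕ) :
    (insertions b m).Finite :=
  finite_insertions_of_proper (finite_properInsertions hb) m

lemma ncard_insertions_of_proper {b : List ℕ} (hb : DescendsByOne b) {k : ℕ}
    (h : ∀ m, (properInsertions b m).ncard = k.multichoose m) (m : ℕ) :
    (insertions b m).ncard = (k + 1).multichoose m := by
  induction m with
  | zero => rw [insertions_zero, h]; simp
  | succ m ih =>
    rw [insertions_succ, Set.ncard_union_eq _ ((finite_insertions hb m).image _)
      (finite_properInsertions hb _), Set.ncard_image_of_injective _ List.cons_injective, ih, h,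
      Nat.multichoose_succ_succ, add_comm]
    rw [Set.disjoint_left]
    rintro _ ⟨a, -, rfl⟩ h
    exact h.2 rfl

lemma ncard_properInsertions {b : List ℕ} (hb : DescendsByOne b) (m : ℕ) :
    (properInsertions b m).ncard = (b.count 0).multichoose m := by
  induction b generalizing m with
  | nil =>
    rcases m with _ | m
    · simp [properInsertions_nil_zero]
    · simp [properInsertions_nil_succ]
  | cons c b ih =>
    rcases c with _ | c
    · have hb := descendsByOne_zero_cons.1 hb
      rw [properInsertions_zero_cons, Set.ncard_image_of_injective _ List.cons_injective,
        ncard_insertions_of_proper hb (ih hb), List.count_cons_self]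
    · rw [properInsertions_succ_cons hb, Set.ncard_image_of_injective _ List.cons_injective,
        ih (descendsByOne_succ_cons.1 hb).2]
      simp

lemma ncard_insertions {b : List ℕ} (hb : DescendsByOne b) (m : ℕ) :
    (insertions b m).ncard = (b.count 0 + 1).multichoose m :=
  ncard_insertions_of_proper hb (ncard_properInsertions hb) m

lemma closedInsertions_zero (b : List ℕ) : closedInsertions b 0 = ∅ := by
  ext a
  simp only [closedInsertions, insertions, Set.mem_ofPred_eq, Set.mem_empty_iff_false, iff_false]
  rintro ⟨⟨-, -, h⟩, h0⟩
  exact List.count_eq_zero.1 h ((List.dropWhile_sublist _).subset h0)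

lemma closedInsertions_zero_cons_succ (b : List ℕ) (m : ℕ) :
    closedInsertions (0 :: b) (m + 1) =
      (List.cons 0) '' closedInsertions (0 :: b) m ∪ (List.cons 1) '' insertions b (m + 1) := by
  ext a
  rcases a with _ | ⟨_ | c, a⟩
  · simp [closedInsertions, insertions]
  · simp [closedInsertions, insertions, descendsByOne_zero_cons]
  · simp [closedInsertions, insertions, descendsByOne_succ_cons]
    constructor
    · rintro ⟨⟨⟨-, h⟩, ⟨rfl, h'⟩, h''⟩, -⟩
      exact ⟨⟨h, h', h''⟩, rfl⟩
    · rintro ⟨⟨h, h', h''⟩, rfl⟩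
      refine ⟨⟨⟨by simp, h⟩, ⟨rfl, h'⟩, h''⟩, ?_⟩
      have : 0 ∈ a := List.count_pos_iff.1 (by omega)
      simpa using this

lemma ncard_closedInsertions {b : List ℕ} (hb : DescendsByOne (0 :: b)) (m : ℕ) :
    (closedInsertions (0 :: b) m).ncard + 1 = ((0 :: b).count 0 + 1).multichoose m := by
  have hb' := descendsByOne_zero_cons.1 hb
  induction m with
  | zero => simp [closedInsertions_zero]
  | succ m ih =>
    rw [closedInsertions_zero_cons_succ, Set.ncard_union_eq _
      (((finite_insertions hb m).subset fun _ h => h.1).image _)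
      ((finite_insertions hb' _).image _),
      Set.ncard_image_of_injective _ List.cons_injective,
      Set.ncard_image_of_injective _ List.cons_injective, ncard_insertions hb',
      Nat.multichoose_succ_succ ((0 :: b).count 0), ← ih, List.count_cons_self]
    · ring
    · rw [Set.disjoint_left]
      rintro _ ⟨a, -, rfl⟩ ⟨c, -, h⟩
      simp at h

lemma IsCatalanList.exists_eq_zero_cons {a : List ℕ} (h : IsCatalanList a) (h0 : a ≠ []) :
    ∃ a', a = 0 :: a' := by
  rcases a with _ | ⟨_ | c, a⟩
  · exact absurd rfl h0
  · exact ⟨a, rfl⟩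
  · simpa using (h.2 c (by simp)).1

lemma isCatalanList_zero_cons {a : List ℕ} :
    IsCatalanList (0 :: a) ↔ DescendsByOne a ∧ IsCatalanList (lowerLetters a) ∧
      (lowerLetters a ≠ [] → 0 ∈ a.dropWhile (· ≠ 1)) := by
  have h0 : FirstBracketed 0 (0 :: a) ↔ (1 ∈ a → 0 ∈ a.dropWhile (· ≠ 1)) := by
    simp [FirstBracketed]
  have hs (k : ℕ) : FirstBracketed (k + 1) (0 :: a) ↔ FirstBracketed k (lowerLetters a) := by
    rw [← firstBracketed_lowerLetters, lowerLetters_zero_cons]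
  constructor
  · intro h
    have hd := descendsByOne_zero_cons.1 h.1
    have hl : IsCatalanList (lowerLetters a) := ⟨hd.lowerLetters, fun k => (hs k).1 (h.2 _)⟩
    refine ⟨hd, hl, fun hne => h0.1 (h.2 0) ?_⟩
    obtain ⟨b, hb⟩ := hl.exists_eq_zero_cons hne
    exact mem_lowerLetters.1 (by simp [hb])
  · rintro ⟨hd, hl, hz⟩
    refine ⟨descendsByOne_zero_cons.2 hd, fun k => ?_⟩
    rcases k with _ | k
    · refine h0.2 fun h1 => hz fun h => ?_
      have := mem_lowerLetters.2 h1
      simp [h] at this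
    · exact (hs k).2 (hl.2 k)

/-- The Catalan lists of length `n`. -/
def catalanLists (n : ℕ) : Set (List ℕ) :=
  {a | IsCatalanList a ∧ a.length = n}

lemma catalanLists_zero : catalanLists 0 = {[]} := by
  ext a
  simp only [catalanLists, Set.mem_ofPred_eq, List.length_eq_zero_iff, Set.mem_singleton_iff,
    and_iff_right_iff_imp]
  rintro rfl
  simp [IsCatalanList, DescendsByOne, FirstBracketed]

lemma finite_catalanLists (n : ℕ) : (catalanLists n).Finite := by
  induction n using Nat.strong_induction_on with
  | _ n ih =>
    rcases n with _ | n
    · simp [catalanLists_zero]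
    have hfin : (⋃ N : Fin (n + 1), ⋃ b ∈ catalanLists N,
        (List.cons 0) '' insertions b (n - N)).Finite :=
      Set.finite_iUnion fun N => (ih N N.2).biUnion fun b hb =>
        (finite_insertions hb.1.1 _).image _
    refine hfin.subset ?_
    rintro a ⟨ha, hl⟩
    obtain ⟨a, rfl⟩ := ha.exists_eq_zero_cons (by rintro rfl; simp at hl)
    obtain ⟨hd, hc, -⟩ := isCatalanList_zero_cons.1 ha
    have := length_lowerLetters_add_count a
    simp only [List.length_cons, Nat.add_right_cancel_iff] at hl
    simp only [Set.mem_iUnion]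
    exact ⟨⟨(lowerLetters a).length, by omega⟩, lowerLetters a, ⟨hc, rfl⟩, a,
      ⟨hd, rfl, by simp only; omega⟩, rfl⟩

/-- The number of Catalan lists of length `n` with `m` zeros. -/
noncomputable def catalanListCount (n m : ℕ) : ℕ :=
  {a | a ∈ catalanLists n ∧ a.count 0 = m}.ncard

lemma catalanListCount_self_succ (M : ℕ) : catalanListCount (M + 1) (M + 1) = 1 := by
  rw [catalanListCount, Set.ncard_eq_one]
  refine ⟨List.replicate (M + 1) 0, ?_⟩
  ext a
  simp only [catalanLists, Set.mem_ofPred_eq, Set.mem_singleton_iff]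
  constructor
  · rintro ⟨⟨-, hl⟩, hc⟩
    rw [List.eq_replicate_iff]
    refine ⟨hl, fun b hb => ?_⟩
    exact (List.count_eq_length.1 (hc.trans hl.symm) b hb).symm
  · rintro rfl
    refine ⟨⟨⟨?_, fun k hk => ?_⟩, by simp⟩, by simp⟩
    · exact List.isChain_replicate_of_rel _ (by simp)
    · simp at hk

lemma catalanListCount_recurrence {N : ℕ} (hN : N ≠ 0) (M : ℕ) :
    catalanListCount (N + M + 1) (M + 1) + (catalanLists N).ncard =
      ∑ b ∈ (finite_catalanLists N).toFinset, (b.count 0 + 1).multichoose M := by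
  classical
  have hfin : {a | a ∈ catalanLists (N + M + 1) ∧ a.count 0 = M + 1}.Finite :=
    (finite_catalanLists _).subset fun _ h => h.1
  have hmaps : Set.MapsTo lowerLetters (hfin.toFinset : Set (List ℕ))
      ((finite_catalanLists N).toFinset : Set (List ℕ)) := by
    intro a ha
    simp only [Set.Finite.coe_toFinset, Set.mem_ofPred_eq] at ha ⊢
    obtain ⟨⟨ha, hl⟩, hc⟩ := ha
    obtain ⟨a, rfl⟩ := ha.exists_eq_zero_cons (by rintro rfl; simp at hl)
    have := length_lowerLetters_add_count (0 :: a)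
    exact ⟨(isCatalanList_zero_cons.1 ha).2.1, by omega⟩
  rw [catalanListCount, Set.ncard_eq_toFinset_card _ hfin,
    Finset.card_eq_sum_card_fiberwise hmaps,
    Set.ncard_eq_toFinset_card _ (finite_catalanLists N), Finset.card_eq_sum_ones,
    ← Finset.sum_add_distrib]
  refine Finset.sum_congr rfl fun b hb => ?_
  rw [Set.Finite.mem_toFinset] at hb
  have hb0 : b ≠ [] := by rintro rfl; exact hN hb.2.symm
  obtain ⟨b', rfl⟩ := hb.1.exists_eq_zero_cons hb0
  rw [← ncard_closedInsertions hb.1.1, ← Set.ncard_coe_finset,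
    ← Set.ncard_image_of_injective (closedInsertions _ _) (List.cons_injective (a := 0))]
  congr 2
  ext a
  simp only [Finset.coe_filter, Set.Finite.mem_toFinset, Set.mem_ofPred_eq, Set.mem_image]
  constructor
  · rintro ⟨⟨⟨ha, hl⟩, hc⟩, hlow⟩
    obtain ⟨a, rfl⟩ := ha.exists_eq_zero_cons (by rintro rfl; simp at hl)
    obtain ⟨hd, -, hz⟩ := isCatalanList_zero_cons.1 ha
    rw [lowerLetters_zero_cons] at hlow
    exact ⟨a, ⟨⟨hd, hlow, by simpa using hc⟩, hz (by simp [hlow])⟩, rfl⟩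
  · rintro ⟨a, ⟨⟨hd, hlow, hc⟩, hz⟩, rfl⟩
    have := length_lowerLetters_add_count a
    have hb2 := hb.2
    refine ⟨⟨⟨isCatalanList_zero_cons.2 ⟨hd, hlow ▸ hb.1, fun _ => hz⟩, ?_⟩, ?_⟩, hlow⟩
    · rw [hlow] at this
      rw [List.length_cons]
      omega
    · simpa using hc

/-- The ballot numbers: `ballot m j` is the coefficient of `X ^ j` in the `m`-th power of the
generating function of the Catalan numbers. -/
def ballot : ℕ → ℕ → ℕ
  | _, 0 => 1
  | 0, _ + 1 => 0
  | m + 1, j + 1 => ballot m (j + 1) + ballot (m + 2) j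
termination_by m j => (j, m)

@[simp] lemma ballot_zero_right (m : ℕ) : ballot m 0 = 1 := by
  cases m <;> simp [ballot]

@[simp] lemma ballot_zero_succ (j : ℕ) : ballot 0 (j + 1) = 0 := by
  simp [ballot]

lemma ballot_succ_succ (m j : ℕ) :
    ballot (m + 1) (j + 1) = ballot m (j + 1) + ballot (m + 2) j := by
  rw [ballot]

lemma sum_ballot_mul_multichoose (N M r : ℕ) :
    ∑ i ∈ Finset.range (N + 1), ballot (i + r) (N - i) * M.multichoose i = ballot (M + r) N := by
  induction N generalizing M r with
  | zero => simp
  | succ N ihN =>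
    induction M with
    | zero => rw [Finset.sum_range_succ']; simp
    | succ M ihM =>
      rw [Finset.sum_range_succ'] at ihM ⊢
      simp only [Nat.multichoose_succ_succ, mul_add, Finset.sum_add_distrib]
      have h := ihN (M + 1) (r + 1)
      rw [show M + 1 + r = M + r + 1 by ring, ballot_succ_succ, ← ihM,
        show M + r + 2 = M + 1 + (r + 1) by ring, ← h]
      simp only [Nat.multichoose_zero_right, Nat.add_sub_add_right, add_assoc, add_comm 1 r]
      ring

lemma sum_ballot_mul_multichoose_succ (N M : ℕ) :
    ∑ i ∈ Finset.range (N + 1), ballot i (N - i) * (M + 1).multichoose (i + 1) =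
      ballot M (N + 1) + ∑ i ∈ Finset.range (N + 1), ballot i (N - i) := by
  induction M with
  | zero => simp
  | succ M ih =>
    simp only [Nat.multichoose_succ_succ (M + 1), mul_add, Finset.sum_add_distrib]
    have h := sum_ballot_mul_multichoose N (M + 2) 0
    simp only [add_zero] at h
    rw [ih, h, ballot_succ_succ]
    ring

lemma sum_catalanLists {N : ℕ} (g : ℕ → ℕ) :
    ∑ b ∈ (finite_catalanLists (N + 1)).toFinset, g (b.count 0) =
      ∑ i ∈ Finset.range (N + 1), catalanListCount (N + 1) (i + 1) * g (i + 1) := by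
  classical
  have hmaps : ∀ b ∈ (finite_catalanLists (N + 1)).toFinset,
      b.count 0 - 1 ∈ Finset.range (N + 1) := by
    intro b hb
    rw [Set.Finite.mem_toFinset] at hb
    have h1 := hb.2
    have h2 : b.count 0 ≤ b.length := List.count_le_length
    rw [Finset.mem_range]
    omega
  rw [← Finset.sum_fiberwise_of_maps_to hmaps]
  refine Finset.sum_congr rfl fun i _ => ?_
  have hset : (((finite_catalanLists (N + 1)).toFinset.filter
      fun b => b.count 0 - 1 = i : Finset (List ℕ)) : Set (List ℕ)) =
      {a | a ∈ catalanLists (N + 1) ∧ a.count 0 = i + 1} := by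
    ext b
    simp only [Finset.coe_filter, Set.Finite.mem_toFinset, Set.mem_ofPred_eq]
    refine and_congr_right fun hb => ?_
    obtain ⟨b, rfl⟩ := hb.1.exists_eq_zero_cons (by rintro rfl; simpa using hb.2)
    simp
  rw [catalanListCount, ← hset, Set.ncard_coe_finset, ← smul_eq_mul]
  refine Finset.sum_eq_card_nsmul fun b hb => ?_
  have : b ∈ {a | a ∈ catalanLists (N + 1) ∧ a.count 0 = i + 1} := hset ▸ hb
  rw [this.2]

lemma catalanListCount_eq_ballot (N M : ℕ) :
    catalanListCount (N + M + 1) (M + 1) = ballot M N := by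
  induction N using Nat.strong_induction_on generalizing M with
  | _ N ih =>
    rcases N with _ | N
    · simpa using catalanListCount_self_succ M
    have hcount : ∀ i ∈ Finset.range (N + 1),
        catalanListCount (N + 1) (i + 1) = ballot i (N - i) := by
      intro i hi
      rw [Finset.mem_range] at hi
      rw [← ih (N - i) (by omega) i]
      congr 1
      omega
    have hcard := sum_catalanLists (N := N) fun _ => 1
    have hrec := catalanListCount_recurrence N.succ_ne_zero M
    rw [sum_catalanLists fun k => (k + 1).multichoose M] at hrec
    rw [← Finset.card_eq_sum_ones, ← Set.ncard_eq_toFinset_card _ (finite_catalanLists (N + 1))] at hcard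
    have hsymm (i : ℕ) : (i + 1 + 1).multichoose M = (M + 1).multichoose (i + 1) := by
      rw [Nat.multichoose_eq, Nat.multichoose_eq,
        show i + 1 + 1 + M - 1 = i + 1 + M by omega, show M + 1 + (i + 1) - 1 = i + 1 + M by omega,
        Nat.choose_symm_add]
    have hsum := sum_ballot_mul_multichoose_succ N M
    simp only [hsymm] at hrec
    rw [Finset.sum_congr rfl fun i hi => by rw [hcount i hi]] at hrec
    rw [Finset.sum_congr rfl fun i hi => by rw [hcount i hi]] at hcard
    simp only [mul_one] at hcard
    rw [hsum, hcard] at hrec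
    exact Nat.add_right_cancel hrec

lemma firstBracketed_iff_of_first {k i : ℕ} {a : List ℕ} (hi : i < a.length) (hk : a[i] = k + 1)
    (hmin : ∀ (j : ℕ) (hj : j < i), a[j] ≠ k + 1) :
    FirstBracketed k a ↔ (∃ (j : ℕ) (h : j < a.length), j < i ∧ a[j] = k) ∧
      ∃ (j : ℕ) (h : j < a.length), i < j ∧ a[j] = k := by
  have hpos : ∀ c ∈ a.take i, (decide (c ≠ k + 1)) = true := by
    intro c hc
    obtain ⟨j, hj, rfl⟩ := List.mem_take_iff_getElem.1 hc
    simpa using hmin j (by omega)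
  have hdrop : a.drop i = (k + 1) :: a.drop (i + 1) := by
    rw [← hk, List.getElem_cons_drop]
  have htake : a.takeWhile (· ≠ k + 1) = a.take i := by
    conv_lhs => rw [← List.take_append_drop i a]
    rw [List.takeWhile_append_of_pos hpos, hdrop]
    simp
  have hdropWhile : a.dropWhile (· ≠ k + 1) = (k + 1) :: a.drop (i + 1) := by
    conv_lhs => rw [← List.take_append_drop i a]
    rw [List.dropWhile_append_of_pos hpos, hdrop]
    simp
  have hmem : k + 1 ∈ a := hk ▸ List.getElem_mem hi
  rw [FirstBracketed, htake, hdropWhile, List.mem_take_iff_getElem, List.mem_cons,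
    List.mem_drop_iff_getElem]
  simp only [hmem, true_implies]
  refine and_congr ?_ ?_
  · constructor
    · rintro ⟨j, hj, h⟩
      exact ⟨j, by omega, by omega, h⟩
    · rintro ⟨j, hj, hji, h⟩
      exact ⟨j, by omega, h⟩
  · constructor
    · rintro (h | ⟨j, hj, h⟩)
      · omega
      · exact ⟨i + 1 + j, by omega, by omega, h⟩
    · rintro ⟨j, hj, hji, h⟩
      obtain ⟨d, rfl⟩ := Nat.exists_eq_add_of_lt hji
      refine Or.inr ⟨d, by omega, ?_⟩
      simpa only [show i + 1 + d = i + d + 1 by omega] using h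

lemma isCatalanList_ofFn {n : ℕ} (f : Fin n → ℕ) :
    IsCatalanList (List.ofFn f) ↔ IsCatalanWord f := by
  refine and_congr ?_ ?_
  · simp [DescendsByOne, List.isChain_iff_getElem]
  · have key (i : Fin n) (k : ℕ) (hk : f i = k + 1) (hmin : ∀ j, f j = f i → i ≤ j) :
        FirstBracketed k (List.ofFn f) ↔
          (∃ j, j < i ∧ f j + 1 = f i) ∧ ∃ j, i < j ∧ f j + 1 = f i := by
      rw [firstBracketed_iff_of_first (i := i) (by simp) (by simpa using hk)]
      · simp only [Fin.exists_iff, List.length_ofFn, List.getElem_ofFn, Fin.lt_def, hk,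
          Nat.add_right_cancel_iff]
      · intro j hj hjk
        have hj' : j < n := hj.trans i.2
        have := hmin ⟨j, hj'⟩ (by simpa [hk] using hjk)
        exact absurd hj (not_lt.2 this)
    constructor
    · intro h i hi hmin
      obtain ⟨k, hk⟩ := Nat.exists_eq_succ_of_ne_zero hi.ne'
      exact (key i k hk hmin).1 (h k)
    · intro h k hmem
      have hex : ∃ j, ∃ hj : j < n, f ⟨j, hj⟩ = k + 1 := by
        simpa [List.mem_ofFn, Fin.exists_iff] using hmem
      classical
      obtain ⟨hi, hk⟩ := Nat.find_spec hex
      have hmin : ∀ j, f j = f ⟨Nat.find hex, hi⟩ → ⟨Nat.find hex, hi⟩ ≤ j := fun j hj =>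
        Nat.find_min' hex ⟨j.2, hj.trans hk⟩
      exact (key _ k hk hmin).2 (h _ (by omega) hmin) hmem

lemma count_ofFn_eq_countEq {n : ℕ} (f : Fin n → ℕ) (c : ℕ) :
    (List.ofFn f).count c = countEq f c := by
  have hcard {n : ℕ} (f : Fin n → ℕ) : countEq f c = (Finset.univ.filter (f · = c)).card := by
    rw [countEq, ← Set.ncard_coe_finset]
    simp
  induction n with
  | zero => simp [hcard]
  | succ n ih =>
    rw [hcard, Fin.card_filter_univ_succ, List.ofFn_succ, List.count_cons, ih, hcard]
    by_cases h : f 0 = c <;> simp [h]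

lemma aZ_eq_catalanListCount (n m : ℕ) : aZ n m = catalanListCount n m := by
  rw [aZ, catalanListCount, ← Set.ncard_image_of_injective _ List.ofFn_injective]
  congr 1
  ext a
  simp only [catalanLists, Set.mem_image, Set.mem_ofPred_eq]
  constructor
  · rintro ⟨f, ⟨hf, hm⟩, rfl⟩
    exact ⟨⟨(isCatalanList_ofFn f).2 hf, by simp⟩, (count_ofFn_eq_countEq f 0).trans hm⟩
  · rintro ⟨⟨ha, rfl⟩, hm⟩
    refine ⟨a.get, ⟨?_, ?_⟩, List.ofFn_get a⟩
    · rwa [← isCatalanList_ofFn, List.ofFn_get]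
    · rwa [← count_ofFn_eq_countEq, List.ofFn_get]

lemma Cfun_eq {x : ℝ} (hx0 : 0 < x) (hx : x < 1 / 4) : Cfun x = 1 + x * Cfun x ^ 2 := by
  have h := Real.sq_sqrt (show 0 ≤ 1 - 4 * x by linarith)
  rw [Cfun]
  field_simp
  linear_combination -h

lemma two_mul_mul_Cfun_lt_one {x : ℝ} (hx0 : 0 < x) (hx : x < 1 / 4) : 2 * x * Cfun x < 1 := by
  have h := Real.sqrt_pos.2 (show 0 < 1 - 4 * x by linarith)
  rw [Cfun, mul_div_cancel₀ _ (by positivity)]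
  linarith

lemma Cfun_pos {x : ℝ} (hx0 : 0 < x) : 0 < Cfun x := by
  have h : √(1 - 4 * x) < 1 := (Real.sqrt_lt' one_pos).2 (by linarith)
  exact div_pos (by linarith) (by linarith)

lemma Cfun_lt_two {x : ℝ} (hx0 : 0 < x) (hx : x < 1 / 4) : Cfun x < 2 := by
  nlinarith [Cfun_eq hx0 hx, two_mul_mul_Cfun_lt_one hx0 hx, Cfun_pos hx0]

lemma sum_ballot_mul_pow_le {x : ℝ} (hx0 : 0 < x) (hx : x < 1 / 4) (m J : ℕ) :
    ∑ j ∈ Finset.range J, (ballot m j : ℝ) * x ^ j ≤ Cfun x ^ m := by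
  have hC := Cfun_pos hx0
  induction J generalizing m with
  | zero => simpa using (pow_pos hC m).le
  | succ J ihJ =>
    induction m with
    | zero => rw [Finset.sum_range_succ']; simp
    | succ m ihm =>
      rw [Finset.sum_range_succ'] at ihm ⊢
      have h := mul_le_mul_of_nonneg_left (ihJ (m + 2)) hx0.le
      have hsum : ∑ j ∈ Finset.range J, (ballot (m + 1) (j + 1) : ℝ) * x ^ (j + 1) =
          ∑ j ∈ Finset.range J, (ballot m (j + 1) : ℝ) * x ^ (j + 1) +
            x * ∑ j ∈ Finset.range J, (ballot (m + 2) j : ℝ) * x ^ j := by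
        rw [Finset.mul_sum, ← Finset.sum_add_distrib]
        refine Finset.sum_congr rfl fun j _ => ?_
        rw [ballot_succ_succ]
        push_cast
        ring
      have hpow : Cfun x ^ (m + 1) = Cfun x ^ m + x * Cfun x ^ (m + 2) := by
        rw [pow_succ]
        nth_rewrite 2 [Cfun_eq hx0 hx]
        ring
      rw [hsum, hpow]
      simp only [ballot_zero_right] at ihm ⊢
      linarith

lemma summable_ballot {x : ℝ} (hx0 : 0 < x) (hx : x < 1 / 4) (m : ℕ) :
    Summable fun j => (ballot m j : ℝ) * x ^ j :=
  summable_of_sum_range_le (fun _ => by positivity) (sum_ballot_mul_pow_le hx0 hx m)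

lemma tsum_ballot_succ {x : ℝ} (hx0 : 0 < x) (hx : x < 1 / 4) (m : ℕ) :
    ∑' j, (ballot (m + 1) j : ℝ) * x ^ j =
      ∑' j, (ballot m j : ℝ) * x ^ j + x * ∑' j, (ballot (m + 2) j : ℝ) * x ^ j := by
  have hs := summable_ballot hx0 hx
  rw [(hs (m + 1)).tsum_eq_zero_add, (hs m).tsum_eq_zero_add, ← tsum_mul_left, add_assoc,
    ← ((summable_nat_add_iff 1).2 (hs m)).tsum_add ((hs (m + 2)).mul_left x)]
  congr 1
  · simp
  · refine tsum_congr fun j => ?_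
    rw [ballot_succ_succ]
    push_cast
    ring

lemma tsum_ballot {x : ℝ} (hx0 : 0 < x) (hx : x < 1 / 4) (m : ℕ) :
    ∑' j, (ballot m j : ℝ) * x ^ j = Cfun x ^ m := by
  set C := Cfun x
  set s : ℕ → ℝ := fun m => ∑' j, (ballot m j : ℝ) * x ^ j
  have hC0 : 0 < C := Cfun_pos hx0
  have hCeq : C = 1 + x * C ^ 2 := Cfun_eq hx0 hx
  have hs0 : s 0 = 1 := by
    refine (tsum_eq_single 0 fun j hj => ?_).trans (by simp)
    obtain ⟨j, rfl⟩ := Nat.exists_eq_succ_of_ne_zero hj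
    simp
  have hsnn (m) : 0 ≤ s m := tsum_nonneg fun _ => by positivity
  have hsle (m) : s m ≤ C ^ m :=
    Real.tsum_le_of_sum_range_le (fun _ => by positivity) (sum_ballot_mul_pow_le hx0 hx m)
  have hrec (m) : s (m + 1) = s m + x * s (m + 2) := tsum_ballot_succ hx0 hx m
  have hgeom (m) : (x * C) ^ m * (C ^ (m + 1) - s (m + 1) - C * (C ^ m - s m)) = C - s 1 := by
    induction m with
    | zero => simp [hs0]
    | succ m ih =>
      rw [← ih, pow_succ, mul_assoc]
      congr 1
      have := hrec m
      linear_combination C * this + (-s (m + 1)) * hCeq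
  have hle (m : ℕ) : C - s 1 ≤ C * (x * C ^ 2) ^ m := by
    rw [← hgeom m]
    have h1 : C ^ (m + 1) - s (m + 1) - C * (C ^ m - s m) ≤ C ^ (m + 1) := by
      nlinarith [hsnn (m + 1), mul_nonneg hC0.le (sub_nonneg.2 (hsle m))]
    calc _ ≤ (x * C) ^ m * C ^ (m + 1) := mul_le_mul_of_nonneg_left h1 (by positivity)
      _ = _ := by ring
  have hlim : Filter.Tendsto (fun m : ℕ => C * (x * C ^ 2) ^ m) Filter.atTop (nhds (C * 0)) :=
    (tendsto_pow_atTop_nhds_zero_of_lt_one (by positivity)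
      (by have := Cfun_lt_two hx0 hx; linarith)).const_mul C
  have hs1 : s 1 = C := by
    have h1 : C - s 1 ≤ C * 0 := ge_of_tendsto' hlim hle
    have h2 := hsle 1
    rw [pow_one] at h2
    linarith
  change s m = C ^ m
  induction m with
  | zero => simp [hs0]
  | succ m ih =>
    have h := hgeom m
    rw [hs1, sub_self, ih, sub_self, mul_zero, sub_zero] at h
    have := (mul_eq_zero.1 h).resolve_left (by positivity)
    linarith

lemma Aterm_succ (x u : ℝ) (N : ℕ) :
    Aterm x u (N + 1) = ∑ p ∈ Finset.HasAntidiagonal.antidiagonal N,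
      x * u * (x * u) ^ p.1 * ((ballot p.1 p.2 : ℝ) * x ^ p.2) := by
  rw [Finset.Nat.sum_antidiagonal_eq_sum_range_succ_mk, Aterm,
    ← Finset.Ico_add_one_right_eq_Icc, Finset.sum_Ico_eq_sum_range]
  refine Finset.sum_congr rfl fun i hi => ?_
  obtain ⟨j, rfl⟩ := Nat.exists_eq_add_of_le (Nat.lt_succ_iff.1 (Finset.mem_range.1 hi))
  rw [aZ_eq_catalanListCount, add_comm 1 i, add_comm i j, catalanListCount_eq_ballot,
    Nat.add_sub_cancel]
  ring

lemma hasSum_Aterm {x u : ℝ} (hx0 : 0 < x) (hx : x < 1 / 4) (hu : 0 ≤ u)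
    (h : x * u * Cfun x < 1) :
    HasSum (Aterm x u) (x * u / (1 - x * u * Cfun x)) := by
  have hC := Cfun_pos hx0
  set f : ℕ × ℕ → ℝ := fun p => x * u * (x * u) ^ p.1 * ((ballot p.1 p.2 : ℝ) * x ^ p.2)
  have hinner (i : ℕ) : HasSum (fun j => f (i, j)) (x * u * (x * u * Cfun x) ^ i) := by
    have := ((summable_ballot hx0 hx i).hasSum.mul_left (x * u * (x * u) ^ i))
    rw [tsum_ballot hx0 hx] at this
    rwa [mul_pow (x * u) (Cfun x), ← mul_assoc]
  have houter : HasSum (fun i => x * u * (x * u * Cfun x) ^ i) (x * u / (1 - x * u * Cfun x)) :=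
    (hasSum_geometric_of_lt_one (by positivity) h).mul_left _
  have hsummable : Summable f := by
    rw [summable_prod_of_nonneg fun _ => by positivity]
    exact ⟨fun i => (hinner i).summable, by simpa only [(hinner _).tsum_eq] using houter.summable⟩
  have hsum : HasSum f (x * u / (1 - x * u * Cfun x)) := by
    rw [← (hsummable.hasSum.prod_fiberwise hinner).unique houter]
    exact hsummable.hasSum
  have hanti := (Finset.HasAntidiagonal.sigmaAntidiagonalEquivProd.hasSum_iff.2 hsum).sigma
    fun N => hasSum_fintype _
  rw [← add_zero (_ / _), ← show ∑ i ∈ Finset.range 1, Aterm x u i = 0 by simp [Aterm],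
    ← hasSum_nat_add_iff]
  refine hanti.congr_fun fun N => ?_
  rw [Aterm_succ, ← Finset.sum_coe_sort]
  rfl

/-- The functional equation
`A(x,v) = (xv/(1-xv))(1 - x C(x)) + (xv/(1-xv)) A(x, 1/(1-xv))`
for `0 < x < 1/5` and `0 ≤ v ≤ 1`, including convergence of both series involved. -/
theorem A_functional_equation (x v : ℝ) (hx0 : 0 < x) (hx : x < 1/5) (hv0 : 0 ≤ v) (hv1 : v ≤ 1) :
    Summable (Aterm x v) ∧ Summable (Aterm x (1 / (1 - x * v))) ∧
    ∑' n : ℕ, Aterm x v n =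
      x * v / (1 - x * v) * (1 - x * Cfun x) +
        x * v / (1 - x * v) * ∑' n : ℕ, Aterm x (1 / (1 - x * v)) n := by
  have hx4 : x < 1 / 4 := by linarith
  have hC := Cfun_pos hx0
  have hC2 := Cfun_lt_two hx0 hx4
  have hCeq := Cfun_eq hx0 hx4
  have hxv : x * v ≤ x := mul_le_of_le_one_right hx0.le hv1
  have hpos : 0 < 1 - x * v := by linarith
  have h1 : x * v * Cfun x < 1 := by nlinarith
  have hxC : x * Cfun x < 1 - x * v := by nlinarith
  have h2 : x * (1 / (1 - x * v)) * Cfun x < 1 := by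
    rw [mul_one_div, div_mul_eq_mul_div, div_lt_one hpos]
    exact hxC
  have hA1 := hasSum_Aterm hx0 hx4 hv0 h1
  have hA2 := hasSum_Aterm hx0 hx4 (one_div_pos.2 hpos).le h2
  refine ⟨hA1.summable, hA2.summable, ?_⟩
  rw [hA1.tsum_eq, hA2.tsum_eq]
  have e1 : x * (1 / (1 - x * v)) / (1 - x * (1 / (1 - x * v)) * Cfun x) =
      x / (1 - x * v - x * Cfun x) := by
    have : 1 - x * v - x * Cfun x ≠ 0 := by linarith
    have : 1 - x * (1 / (1 - x * v)) * Cfun x ≠ 0 := by linarith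
    field_simp
  rw [e1]
  have n1 : 1 - x * v * Cfun x ≠ 0 := by linarith
  have n2 : 1 - x * v - x * Cfun x ≠ 0 := by linarith
  generalize Cfun x = C at *
  field_simp
  linear_combination v * ((1 - x * v * C) * x + (1 - x * v) * (x * v)) * hCeq
end
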